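/- No head atom repeats in a truth-greedy chase: let A be an arbitrary type of ground atoms, Π a set of ground rules over A, and D : A → [0,1] a fuzzy dataset. Let r₁, r₂, … be a (finite or infinite) sequence of rules of Π and I₀ = D, I₁, I₂, … interpretations such that each r_i is active in I_{i−1}, each I_i is the result of applying r_i to I_{i−1}, and the sequence is truth-greedy. Then head(r_i) ≠ head(r_j) whenever i ≠ j. -/

import Mathlib

/-- A t-norm: a commutative, associative, monotone binary operation on the real
unit interval with 1 as identity element. -/
structure Tnorm where
  toFun : unitInterval → unitInterval → unitInterval
  comm : ∀ a b, toFun a b = toFun b a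
  assoc : ∀ a b c, toFun (toFun a b) c = toFun a (toFun b c)
  mono : ∀ a a' b, a ≤ a' → toFun a b ≤ toFun a' b
  one_identity : ∀ a, toFun a 1 = a

/-- A ground rule over a type `A` of ground atoms: a t-norm, a nonempty finite
list of body atoms, and a head atom. -/
structure Rule (A : Type*) where
  tnorm : Tnorm
  body : List A
  body_ne : body ≠ []
  head : A

/-- The body fold of a rule under a fuzzy interpretation `I : A → [0,1]`:
the iterated t-norm of the values of `I` on the body atoms. -/
def Rule.bodyFold {A : Type*} (r : Rule A) (I : A → unitInterval) : unitInterval :=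
  (r.body.map I).foldr r.tnorm.toFun 1

/-- A rule is active in `I` if its body fold strictly exceeds the current
truth degree of its head. -/
def Rule.Active {A : Type*} (r : Rule A) (I : A → unitInterval) : Prop :=
  I r.head < r.bodyFold I

-- The result of applying rule `r` to `I`: the head atom gets the body fold
-- as its new truth degree; all other atoms are unchanged.
open Classical in
noncomputable def Rule.apply {A : Type*} (r : Rule A)
    (I : A → unitInterval) : A → unitInterval :=
  fun X => if X = r.head then r.bodyFold I else I X

theorem Tnorm.toFun_le_right (t : Tnorm) (a b : unitInterval) : t.toFun a b ≤ b := by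
  have h := t.mono a 1 b unitInterval.le_one'
  rwa [t.comm 1 b, t.one_identity] at h

theorem Tnorm.toFun_le_left (t : Tnorm) (a b : unitInterval) : t.toFun a b ≤ a :=
  t.comm a b ▸ t.toFun_le_right b a

theorem Tnorm.foldr_le_of_mem (t : Tnorm) {l : List unitInterval} {a : unitInterval}
    (ha : a ∈ l) : l.foldr t.toFun 1 ≤ a := by
  induction l with
  | nil => simp at ha
  | cons b l ih =>
    rcases List.mem_cons.1 ha with rfl | h
    · exact t.toFun_le_left _ _
    · exact (t.toFun_le_right _ _).trans (ih h)

theorem Rule.bodyFold_le_of_mem {A : Type*} (r : Rule A) (I : A → unitInterval) {X : A}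
    (hX : X ∈ r.body) : r.bodyFold I ≤ I X :=
  r.tnorm.foldr_le_of_mem (List.mem_map_of_mem hX)

theorem Rule.apply_head {A : Type*} (r : Rule A) (I : A → unitInterval) :
    r.apply I r.head = r.bodyFold I := by
  simp [Rule.apply]

theorem Rule.apply_of_ne {A : Type*} (r : Rule A) (I : A → unitInterval) {X : A}
    (hX : X ≠ r.head) : r.apply I X = I X := by
  simp [Rule.apply, hX]

theorem Rule.Active.le_apply {A : Type*} {r : Rule A} {I : A → unitInterval}
    (h : r.Active I) : I ≤ r.apply I := by
  intro X
  by_cases hX : X = r.head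
  · subst hX
    exact r.apply_head I ▸ le_of_lt h
  · exact (r.apply_of_ne I hX).ge

theorem Rule.bodyFold_apply_of_notMem {A : Type*} (r s : Rule A) (I : A → unitInterval)
    (h : r.head ∉ s.body) : s.bodyFold (r.apply I) = s.bodyFold I := by
  unfold Rule.bodyFold
  rw [List.map_congr_left fun X hX => r.apply_of_ne I fun e => h (e ▸ hX)]

/-- If `r` is a greedy choice among the active rules of `P`, then after applying it the body fold
of any active rule of `P` is at most the body fold of `r`. -/
theorem Rule.Active.bodyFold_apply_le {A : Type*} {P : Set (Rule A)} {r s : Rule A}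
    {I : A → unitInterval} (hr : r.Active I)
    (hgreedy : ∀ s ∈ P, s.Active I → s.bodyFold I ≤ r.bodyFold I)
    (hs : s ∈ P) (hact : s.Active (r.apply I)) :
    s.bodyFold (r.apply I) ≤ r.bodyFold I := by
  by_cases h : r.head ∈ s.body
  · exact r.apply_head I ▸ s.bodyFold_le_of_mem (r.apply I) h
  · have hfold := r.bodyFold_apply_of_notMem s I h
    rw [hfold]
    refine hgreedy s hs ?_
    exact (hr.le_apply s.head).trans_lt (hfold ▸ hact)

/-- No head atom repeats in a truth-greedy chase: in a truth-greedy sequence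
of active-rule applications `I₀ = D, I₁, …, I_n` with applied rules
`r₁, …, r_n`, the heads of `r i` and `r j` differ whenever `i ≠ j`. -/
theorem truth_greedy_chase_heads_distinct {A : Type*}
    (P : Set (Rule A)) (D : A → unitInterval) (n : ℕ)
    (r : ℕ → Rule A) (I : ℕ → A → unitInterval)
    (h0 : I 0 = D)
    (hmem : ∀ i, 1 ≤ i → i ≤ n → r i ∈ P)
    (hact : ∀ i, 1 ≤ i → i ≤ n → (r i).Active (I (i - 1)))
    (happ : ∀ i, 1 ≤ i → i ≤ n → I i = (r i).apply (I (i - 1)))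
    (hgreedy : ∀ i, 1 ≤ i → i ≤ n → ∀ s ∈ P, s.Active (I (i - 1)) →
        s.bodyFold (I (i - 1)) ≤ (r i).bodyFold (I (i - 1))) :
    ∀ i j, 1 ≤ i → i ≤ n → 1 ≤ j → j ≤ n → i ≠ j →
      (r i).head ≠ (r j).head := by
  have key : ∀ i k, 1 ≤ i → i + k + 1 ≤ n →
      (r (i + k + 1)).bodyFold (I (i + k)) ≤ (r i).bodyFold (I (i - 1)) ∧
        (r i).bodyFold (I (i - 1)) ≤ I (i + k) (r i).head := by
    have step : ∀ i, 1 ≤ i → i + 1 ≤ n →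
        (r (i + 1)).bodyFold (I i) ≤ (r i).bodyFold (I (i - 1)) := by
      intro i hi hin
      have hnext := hact (i + 1) (by omega) hin
      rw [Nat.add_sub_cancel] at hnext
      rw [happ i hi (by omega)] at hnext ⊢
      exact (hact i hi (by omega)).bodyFold_apply_le (hgreedy i hi (by omega))
        (hmem (i + 1) (by omega) hin) hnext
    intro i k hi hk
    induction k with
    | zero =>
      refine ⟨step i hi hk, ?_⟩
      rw [Nat.add_zero, happ i hi (by omega), Rule.apply_head]
    | succ k ih =>
      obtain ⟨hfold, hval⟩ := ih (by omega)
      refine ⟨(step (i + k + 1) (by omega) hk).trans hfold, hval.trans ?_⟩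
      have hle := (hact (i + k + 1) (by omega) (by omega)).le_apply
      rw [← happ (i + k + 1) (by omega) (by omega)] at hle
      exact hle (r i).head
  have distinct_of_lt : ∀ i j, 1 ≤ i → i < j → j ≤ n → (r i).head ≠ (r j).head := by
    intro i j hi hij hj heq
    obtain ⟨k, rfl⟩ := Nat.exists_eq_add_of_lt hij
    obtain ⟨hfold, hval⟩ := key i k hi hj
    have hlt : I (i + k) (r (i + k + 1)).head < _ := hact (i + k + 1) (by omega) hj
    rw [← heq] at hlt
    exact absurd (hfold.trans hval) (not_le_of_gt hlt)
  intro i j hi hin hj hjn hne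
  rcases Nat.lt_or_gt_of_ne hne with h | h
  · exact distinct_of_lt i j hi h hjn
  · exact (distinct_of_lt j i hj h hin).symm
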